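/- arXiv:2406.16365 — 2 statements merged into one kernel-verified Lean document; each statement's English description precedes it below -/
import Mathlib

section
/- Let d ≥ 1 be a natural number, let b be a real number with 0 < b < min{2, d}, and let σ > 0 be a real number with σ < (4 − 2b)/(d − 2) in case d ≥ 3. Then there exists a constant C > 0 such that for every Schwartz function f : ℝ^d → ℂ one has ∫_{ℝ^d} |x|^{−b} |f(x)|^{σ+2} dx ≤ C · (∫_{ℝ^d} |∇f(x)|² dx)^{(dσ+2b)/4} · (∫_{ℝ^d} |f(x)|² dx)^{(4−2b−σ(d−2))/4}. -/
open MeasureTheory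
open Filter Topology Module
open scoped NNReal ENNReal

theorem exists_cutoff_sequence (E : Type*) [NormedAddCommGroup E] [InnerProductSpace ℝ E]
    [FiniteDimensional ℝ E] :
    ∃ (χ : ℕ → E → ℝ) (c : ℕ → ℝ≥0), (∀ n, ContDiff ℝ 1 (χ n)) ∧ (∀ n, HasCompactSupport (χ n)) ∧
      (∀ n x, ‖χ n x‖ ≤ 1) ∧ (∀ n x, ‖fderiv ℝ (χ n) x‖ ≤ c n) ∧ Tendsto c atTop (𝓝 0) ∧
      ∀ x, Tendsto (fun n ↦ χ n x) atTop (𝓝 1) := by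
  let φ : ContDiffBump (0 : E) := ⟨1, 2, one_pos, one_lt_two⟩
  have hφ : ContDiff ℝ 1 φ := φ.contDiff
  obtain ⟨M, hM⟩ : ∃ M, ∀ x, ‖fderiv ℝ φ x‖ ≤ M :=
    (φ.hasCompactSupport.fderiv ℝ).exists_bound_of_continuous (hφ.continuous_fderiv one_ne_zero)
  have hM0 : 0 ≤ M := (norm_nonneg _).trans (hM 0)
  have hpos (n : ℕ) : (0 : ℝ) < ((n : ℝ) + 1)⁻¹ := by positivity
  have hlim : Tendsto (fun n : ℕ ↦ ((n : ℝ) + 1)⁻¹) atTop (𝓝 0) := by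
    simpa using tendsto_one_div_add_atTop_nhds_zero_nat (𝕜 := ℝ)
  refine ⟨fun n x ↦ φ (((n : ℝ) + 1)⁻¹ • x), fun n ↦ (((n : ℝ) + 1)⁻¹ * M).toNNReal,
    fun n ↦ hφ.comp (contDiff_const_smul _), fun n ↦ ?_, fun n x ↦ ?_, fun n x ↦ ?_, ?_, fun x ↦ ?_⟩
  · exact φ.hasCompactSupport.comp_smul (hpos n).ne'
  · rw [Real.norm_of_nonneg φ.nonneg]
    exact φ.le_one
  · rw [fderiv_comp_smul, norm_smul, Real.norm_of_nonneg (hpos n).le]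
    exact (mul_le_mul_of_nonneg_left (hM _) (hpos n).le).trans (Real.le_coe_toNNReal _)
  · have := continuous_real_toNNReal.tendsto _ |>.comp (hlim.mul_const M)
    simpa [Function.comp_def] using this
  · have hx : Tendsto (fun n : ℕ ↦ ((n : ℝ) + 1)⁻¹ • x) atTop (𝓝 0) := by
      simpa using hlim.smul_const x
    have := (φ.continuous.tendsto 0).comp hx
    rwa [φ.one_of_mem_closedBall (by simp [φ])] at this

theorem exists_eLpNorm_le_eLpNorm_fderiv_of_memLp {E : Type*} [NormedAddCommGroup E]
    [InnerProductSpace ℝ E] [FiniteDimensional ℝ E] [MeasurableSpace E] [BorelSpace E]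
    (F : Type*) [NormedAddCommGroup F] [InnerProductSpace ℝ F]
    (μ : Measure E) [μ.IsAddHaarMeasure] {p p' : ℝ≥0} (hp : 1 ≤ p) (hn : 0 < finrank ℝ E)
    (hp' : (p' : ℝ)⁻¹ = p⁻¹ - (finrank ℝ E : ℝ)⁻¹) :
    ∃ K : ℝ≥0, ∀ u : E → F, ContDiff ℝ 1 u → MemLp u p μ →
      eLpNorm u p' μ ≤ K * eLpNorm (fderiv ℝ u) p μ := by
  refine ⟨eLpNormLESNormFDerivOfEqInnerConst μ p, fun u hu hup ↦ ?_⟩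
  obtain ⟨χ, c, hχ, hχs, hχ1, hχd, hc, hχlim⟩ := exists_cutoff_sequence E
  set K := eLpNormLESNormFDerivOfEqInnerConst μ p
  have hu' : Continuous (fderiv ℝ u) := hu.continuous_fderiv one_ne_zero
  have hbound (n : ℕ) : eLpNorm (fun x ↦ χ n x • u x) p' μ ≤
      K * (eLpNorm (fderiv ℝ u) p μ + c n * eLpNorm u p μ) := by
    refine (eLpNorm_le_eLpNorm_fderiv_of_eq_inner μ ((hχ n).smul hu) (hχs n).smul_right
      hp hn hp').trans ?_
    gcongr
    calc eLpNorm (fderiv ℝ fun x ↦ χ n x • u x) p μ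
        ≤ eLpNorm (fun x ↦ ‖fderiv ℝ u x‖ + ((c n : ℝ) • ‖u x‖)) p μ := by
          refine eLpNorm_mono_real fun x ↦ ?_
          rw [fderiv_fun_smul ((hχ n).differentiable one_ne_zero x)
            (hu.differentiable one_ne_zero x)]
          refine (norm_add_le _ _).trans (add_le_add ?_ ?_)
          · rw [norm_smul]
            exact mul_le_of_le_one_left (norm_nonneg _) (hχ1 n x)
          · rw [ContinuousLinearMap.norm_smulRight_apply]
            exact mul_le_mul_of_nonneg_right (hχd n x) (norm_nonneg _)
      _ ≤ eLpNorm (fun x ↦ ‖fderiv ℝ u x‖) p μ + eLpNorm ((c n : ℝ) • fun x ↦ ‖u x‖) p μ :=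
          eLpNorm_add_le hu'.norm.aestronglyMeasurable
            (hu.continuous.norm.const_smul (c n : ℝ)).aestronglyMeasurable (by exact_mod_cast hp)
      _ ≤ _ := by
          gcongr
          · rw [eLpNorm_norm]
          · rw [eLpNorm_const_smul, eLpNorm_norm]
            simp [enorm_eq_nnnorm]
  have hlim : Tendsto (fun n ↦ (K : ℝ≥0∞) * (eLpNorm (fderiv ℝ u) p μ + c n * eLpNorm u p μ))
      atTop (𝓝 (K * eLpNorm (fderiv ℝ u) p μ)) := by
    have h1 : Tendsto (fun n ↦ (c n : ℝ≥0∞) * eLpNorm u p μ) atTop (𝓝 0) := by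
      have := ENNReal.Tendsto.mul_const (ENNReal.tendsto_coe.2 hc) (Or.inr hup.eLpNorm_ne_top)
      simpa using this
    have h2 := ENNReal.Tendsto.const_mul (h1.const_add (eLpNorm (fderiv ℝ u) p μ))
      (Or.inr (ENNReal.coe_ne_top (r := K)))
    simpa using h2
  refine (Lp.eLpNorm_lim_le_liminf_eLpNorm (f := fun n x ↦ χ n x • u x)
    (fun n ↦ ((hχ n).continuous.smul hu.continuous).aestronglyMeasurable) u
    (.of_forall fun x ↦ by simpa using (hχlim x).smul_const (u x))).trans ?_
  exact (liminf_le_liminf (.of_forall hbound)).trans hlim.liminf_eq.le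

theorem lintegral_mul_le_sqrt_mul_sqrt {α : Type*} [MeasurableSpace α] {μ : Measure α}
    {f g : α → ℝ≥0∞} (hf : AEMeasurable f μ) (hg : AEMeasurable g μ) :
    ∫⁻ a, f a * g a ∂μ ≤
      (∫⁻ a, f a ^ (2 : ℝ) ∂μ) ^ (1 / 2 : ℝ) * (∫⁻ a, g a ^ (2 : ℝ) ∂μ) ^ (1 / 2 : ℝ) :=
  ENNReal.lintegral_mul_le_Lp_mul_Lq μ Real.HolderConjugate.two_two hf hg

theorem eLpNorm_coe_rpow_eq_lintegral {α F : Type*} [MeasurableSpace α] {μ : Measure α}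
    [NormedAddCommGroup F] (f : α → F) {p : ℝ≥0} (hp : p ≠ 0) :
    eLpNorm f p μ ^ (p : ℝ) = ∫⁻ x, ‖f x‖ₑ ^ (p : ℝ) ∂μ :=
  eLpNorm_nnreal_pow_eq_lintegral hp

section EvenPowers

variable {E : Type*} [NormedAddCommGroup E] [InnerProductSpace ℝ E] [FiniteDimensional ℝ E]
  [MeasurableSpace E] [BorelSpace E]

theorem lintegral_enorm_pow_succ_le_of_finrank_eq_two (hE : finrank ℝ E = 2) (k : ℕ) :
    ∃ C : ℝ≥0, ∀ f : SchwartzMap E ℂ, ∫⁻ x, ‖f x‖ₑ ^ (2 * ((k : ℝ) + 1)) ≤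
      C * (∫⁻ x, ‖fderiv ℝ f x‖ₑ ^ (2 : ℝ)) * ∫⁻ x, ‖f x‖ₑ ^ (2 * (k : ℝ)) := by
  obtain ⟨K, hK⟩ := exists_eLpNorm_le_eLpNorm_fderiv_of_memLp ℂ (volume : Measure E) (p := 1)
    (p' := 2) le_rfl (by omega) (by rw [hE]; norm_num)
  refine ⟨(K * (k + 1)) ^ 2, fun f ↦ ?_⟩
  have hf : ContDiff ℝ 1 f := f.smooth 1
  have hu : ContDiff ℝ 1 fun x ↦ f x ^ (k + 1) := hf.pow _
  have hu1 : MemLp (fun x ↦ f x ^ (k + 1)) (1 : ℝ≥0) volume := by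
    obtain ⟨M, -, hM⟩ := f.decay 0 0
    refine MemLp.of_le_mul (f.memLp (1 : ℝ≥0)) hu.continuous.aestronglyMeasurable
      (c := M ^ k) (.of_forall fun x ↦ ?_)
    have hx : ‖f x‖ ≤ M := by simpa using hM x
    rw [norm_pow, pow_succ]
    gcongr
  have hsob := hK _ hu hu1
  have hD (x : E) : ‖fderiv ℝ (fun x ↦ f x ^ (k + 1)) x‖ₑ =
      ((k + 1 : ℝ≥0) : ℝ≥0∞) * (‖f x‖ₑ ^ k * ‖fderiv ℝ f x‖ₑ) := by
    rw [fderiv_fun_pow _ (hf.differentiable one_ne_zero x)]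
    simp only [enorm_eq_nnnorm, nnnorm_mul, nnnorm_pow, nnnorm_smul, nsmul_eq_mul]
    norm_cast
    simp [mul_assoc]
  have hcs : ∫⁻ x, ‖f x‖ₑ ^ k * ‖fderiv ℝ f x‖ₑ ≤ (∫⁻ x, ‖f x‖ₑ ^ (2 * (k : ℝ))) ^ (1 / 2 : ℝ) *
      (∫⁻ x, ‖fderiv ℝ f x‖ₑ ^ (2 : ℝ)) ^ (1 / 2 : ℝ) := by
    refine (lintegral_mul_le_sqrt_mul_sqrt (hf.continuous.enorm.measurable.pow_const k).aemeasurable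
      (hf.continuous_fderiv one_ne_zero).enorm.measurable.aemeasurable).trans_eq ?_
    congr 3
    ext x
    rw [← ENNReal.rpow_natCast, ← ENNReal.rpow_mul, mul_comm]
  rw [ENNReal.coe_one, eLpNorm_one_eq_lintegral_enorm] at hsob
  simp_rw [hD] at hsob
  rw [lintegral_const_mul' _ _ ENNReal.coe_ne_top] at hsob
  have h2 := ENNReal.rpow_le_rpow (hsob.trans (mul_le_mul_right (mul_le_mul_right hcs _) _))
    (zero_le_two (α := ℝ))
  have h3 : eLpNorm (fun x ↦ f x ^ (k + 1)) (2 : ℝ≥0) volume ^ (2 : ℝ) =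
      ∫⁻ x, ‖f x‖ₑ ^ (2 * ((k : ℝ) + 1)) := by
    refine (eLpNorm_coe_rpow_eq_lintegral _ two_ne_zero).trans (lintegral_congr fun x ↦ ?_)
    rw [enorm_pow, ← ENNReal.rpow_natCast, ← ENNReal.rpow_mul]
    push_cast
    rw [mul_comm]
  rw [h3] at h2
  refine h2.trans_eq ?_
  simp only [ENNReal.mul_rpow_of_nonneg _ _ (zero_le_two (α := ℝ)), ← ENNReal.rpow_mul]
  norm_num
  ring

theorem lintegral_enorm_even_pow_le_of_finrank_eq_two (hE : finrank ℝ E = 2) (k : ℕ) :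
    ∃ C : ℝ≥0, ∀ f : SchwartzMap E ℂ, ∫⁻ x, ‖f x‖ₑ ^ (2 * ((k : ℝ) + 1)) ≤
      C * (∫⁻ x, ‖fderiv ℝ f x‖ₑ ^ (2 : ℝ)) ^ (k : ℝ) * ∫⁻ x, ‖f x‖ₑ ^ (2 : ℝ) := by
  induction k with
  | zero => exact ⟨1, fun f ↦ by simp⟩
  | succ k ih =>
    obtain ⟨C, hC⟩ := ih
    obtain ⟨C', hC'⟩ := lintegral_enorm_pow_succ_le_of_finrank_eq_two hE (k + 1)
    refine ⟨C' * C, fun f ↦ (hC' f).trans ?_⟩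
    push_cast
    refine (mul_le_mul_right (hC f) _).trans_eq ?_
    rw [ENNReal.rpow_add_of_nonneg _ _ k.cast_nonneg zero_le_one, ENNReal.rpow_one]
    ring

theorem lintegral_enorm_rpow_le_of_two_lt_finrank (hE : 2 < finrank ℝ E) {q : ℝ} (hq : 0 < q)
    (hq' : q⁻¹ = 2⁻¹ - (finrank ℝ E : ℝ)⁻¹) :
    ∃ C : ℝ≥0, ∀ f : SchwartzMap E ℂ, ∫⁻ x, ‖f x‖ₑ ^ q ≤
      C * (∫⁻ x, ‖fderiv ℝ f x‖ₑ ^ (2 : ℝ)) ^ (q / 2) := by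
  lift q to ℝ≥0 using hq.le
  obtain ⟨K, hK⟩ := exists_eLpNorm_le_eLpNorm_fderiv_of_memLp ℂ (volume : Measure E) (p := 2)
    (p' := q) one_le_two (by omega) (by simpa using hq')
  refine ⟨K ^ (q : ℝ), fun f ↦ ?_⟩
  have hsob := hK _ (f.smooth 1) (f.memLp (2 : ℝ≥0))
  have h2 : eLpNorm (fderiv ℝ f) (2 : ℝ≥0) volume =
      (∫⁻ x, ‖fderiv ℝ f x‖ₑ ^ (2 : ℝ)) ^ (1 / 2 : ℝ) := by
    have := eLpNorm_coe_rpow_eq_lintegral (μ := volume) (fderiv ℝ f) (two_ne_zero (α := ℝ≥0))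
    rw [NNReal.coe_ofNat] at this
    rw [← this, ← ENNReal.rpow_mul]
    norm_num
  rw [h2] at hsob
  rw [← eLpNorm_coe_rpow_eq_lintegral _ (by exact_mod_cast hq.ne')]
  refine (ENNReal.rpow_le_rpow hsob q.coe_nonneg).trans_eq ?_
  rw [ENNReal.mul_rpow_of_nonneg _ _ q.coe_nonneg, ← ENNReal.rpow_mul, ENNReal.coe_rpow_of_nonneg _ q.coe_nonneg]
  congr 2
  ring

end EvenPowers

theorem enorm_sq_le_lintegral_mul_deriv (g : SchwartzMap ℝ ℂ) (t : ℝ) :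
    ‖g t‖ₑ ^ (2 : ℝ) ≤ 2 * ∫⁻ x, ‖g x‖ₑ * ‖deriv g x‖ₑ := by
  have hder (x : ℝ) : HasDerivAt (fun y ↦ g y ^ 2) (2 * (g x * deriv g x)) x := by
    simpa [mul_assoc] using (g.differentiableAt (x := x)).hasDerivAt.fun_pow 2
  have hint : Integrable fun x ↦ 2 * (g x * deriv g x) := by
    refine Integrable.const_mul ?_ 2
    have h1 : MemLp g 2 volume := g.memLp 2
    have h2 : MemLp (SchwartzMap.derivCLM ℂ ℂ g) 2 volume := SchwartzMap.memLp _ 2 volume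
    exact h1.integrable_mul h2
  have hlim : Tendsto (fun y ↦ g y ^ 2) atBot (𝓝 0) := by
    have h1 : Tendsto g (cocompact ℝ) (𝓝 0) := zero_at_infty g
    simpa using (h1.mono_left atBot_le_cocompact).pow 2
  have hft := integral_Iic_of_hasDerivAt_of_tendsto' (a := t) (fun x _ ↦ hder x)
    hint.integrableOn hlim
  calc ‖g t‖ₑ ^ (2 : ℝ) = ‖∫ x in Set.Iic t, 2 * (g x * deriv g x)‖ₑ := by
        rw [hft, sub_zero, enorm_pow, ← ENNReal.rpow_natCast]
        norm_num
    _ ≤ ∫⁻ x in Set.Iic t, ‖2 * (g x * deriv g x)‖ₑ := enorm_integral_le_lintegral_enorm _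
    _ ≤ ∫⁻ x, ‖2 * (g x * deriv g x)‖ₑ := setLIntegral_le_lintegral _ _
    _ = 2 * ∫⁻ x, ‖g x‖ₑ * ‖deriv g x‖ₑ := by
        rw [← lintegral_const_mul' _ _ (by simp)]
        refine lintegral_congr fun x ↦ ?_
        simp [enorm_eq_nnnorm]

section Endpoint

variable {E : Type*} [NormedAddCommGroup E] [InnerProductSpace ℝ E] [FiniteDimensional ℝ E]
  [MeasurableSpace E] [BorelSpace E]

theorem enorm_sq_le_of_finrank_eq_one (hE : finrank ℝ E = 1) (f : SchwartzMap E ℂ) (x : E) :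
    ‖f x‖ₑ ^ (2 : ℝ) ≤ 2 * ((∫⁻ x, ‖f x‖ₑ ^ (2 : ℝ)) ^ (1 / 2 : ℝ) *
      (∫⁻ x, ‖fderiv ℝ f x‖ₑ ^ (2 : ℝ)) ^ (1 / 2 : ℝ)) := by
  let e : ℝ ≃ₗᵢ[ℝ] E := (stdOrthonormalBasis ℝ ℝ).equiv (stdOrthonormalBasis ℝ E)
    (finCongr (by rw [hE, finrank_self]))
  let g : SchwartzMap ℝ ℂ :=
    SchwartzMap.compCLMOfContinuousLinearEquiv ℂ e.toContinuousLinearEquiv f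
  have hf : ContDiff ℝ 1 f := f.smooth 1
  have hg (t : ℝ) : g t = f (e t) := rfl
  have hg' (t : ℝ) : ‖deriv g t‖ₑ ≤ ‖fderiv ℝ f (e t)‖ₑ := by
    have h := (hf.differentiable one_ne_zero (e t)).hasFDerivAt.comp_hasDerivAt t
      (e.toContinuousLinearEquiv : ℝ →L[ℝ] E).hasDerivAt
    have h' : HasDerivAt g (fderiv ℝ f (e t) (e 1)) t := h
    rw [h'.deriv, ← ofReal_norm, ← ofReal_norm]
    refine ENNReal.ofReal_le_ofReal (((fderiv ℝ f (e t)).le_opNorm _).trans_eq ?_)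
    simp
  obtain ⟨t, rfl⟩ := e.surjective x
  calc ‖f (e t)‖ₑ ^ (2 : ℝ) ≤ 2 * ∫⁻ s, ‖g s‖ₑ * ‖deriv g s‖ₑ :=
        enorm_sq_le_lintegral_mul_deriv g t
    _ ≤ 2 * ∫⁻ s, ‖f (e s)‖ₑ * ‖fderiv ℝ f (e s)‖ₑ := by
        refine mul_le_mul_right (lintegral_mono fun s ↦ ?_) _
        exact mul_le_mul' (hg s ▸ le_rfl) (hg' s)
    _ = 2 * ∫⁻ y, ‖f y‖ₑ * ‖fderiv ℝ f y‖ₑ := by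
        congr 1
        exact e.measurePreserving.lintegral_comp_emb e.toMeasurableEquiv.measurableEmbedding
          fun y ↦ ‖f y‖ₑ * ‖fderiv ℝ f y‖ₑ
    _ ≤ _ := by
        gcongr
        exact lintegral_mul_le_sqrt_mul_sqrt hf.continuous.enorm.measurable.aemeasurable
          (hf.continuous_fderiv one_ne_zero).enorm.measurable.aemeasurable

theorem lintegral_enorm_rpow_le_of_finrank_eq_one (hE : finrank ℝ E = 1) {q : ℝ} (hq : 2 ≤ q) :
    ∃ C : ℝ≥0, ∀ f : SchwartzMap E ℂ, ∫⁻ x, ‖f x‖ₑ ^ q ≤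
      C * (∫⁻ x, ‖fderiv ℝ f x‖ₑ ^ (2 : ℝ)) ^ ((q - 2) / 4) *
        (∫⁻ x, ‖f x‖ₑ ^ (2 : ℝ)) ^ ((q - 2) / 4 + 1) := by
  have hq' : 0 ≤ (q - 2) / 2 := by linarith
  refine ⟨2 ^ ((q - 2) / 2), fun f ↦ ?_⟩
  have hpt (x : E) : ‖f x‖ₑ ^ q ≤ (2 * ((∫⁻ x, ‖f x‖ₑ ^ (2 : ℝ)) ^ (1 / 2 : ℝ) *
      (∫⁻ x, ‖fderiv ℝ f x‖ₑ ^ (2 : ℝ)) ^ (1 / 2 : ℝ))) ^ ((q - 2) / 2) * ‖f x‖ₑ ^ (2 : ℝ) := by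
    calc ‖f x‖ₑ ^ q = (‖f x‖ₑ ^ (2 : ℝ)) ^ ((q - 2) / 2) * ‖f x‖ₑ ^ (2 : ℝ) := by
          rw [← ENNReal.rpow_mul, ← ENNReal.rpow_add_of_nonneg _ _ (by linarith) zero_le_two]
          congr 1
          ring
      _ ≤ _ := by
          gcongr
          exact enorm_sq_le_of_finrank_eq_one hE f x
  refine (lintegral_mono hpt).trans ?_
  rw [lintegral_const_mul _ (f.continuous.enorm.measurable.pow_const _)]
  simp only [ENNReal.mul_rpow_of_nonneg _ _ hq', ← ENNReal.rpow_mul]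
  rw [ENNReal.rpow_add_of_nonneg _ _ (by linarith) zero_le_one, ENNReal.rpow_one,
    ENNReal.coe_rpow_of_nonneg _ hq', ENNReal.coe_ofNat,
    show 1 / 2 * ((q - 2) / 2) = (q - 2) / 4 by ring]
  refine le_of_eq ?_
  ring

theorem exists_gagliardo_nirenberg_endpoint (hE : 1 ≤ finrank ℝ E) {r : ℝ}
    (hr : 3 ≤ finrank ℝ E → r * (finrank ℝ E - 2) ≤ 2 * finrank ℝ E) :
    ∃ q : ℝ, 2 < q ∧ r ≤ q ∧ 0 ≤ q / 2 - finrank ℝ E * (q - 2) / 4 ∧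
      ∃ C : ℝ≥0, ∀ f : SchwartzMap E ℂ, ∫⁻ x, ‖f x‖ₑ ^ q ≤
        C * (∫⁻ x, ‖fderiv ℝ f x‖ₑ ^ (2 : ℝ)) ^ (finrank ℝ E * (q - 2) / 4) *
          (∫⁻ x, ‖f x‖ₑ ^ (2 : ℝ)) ^ (q / 2 - finrank ℝ E * (q - 2) / 4) := by
  obtain h1 | h2 | h3 : finrank ℝ E = 1 ∨ finrank ℝ E = 2 ∨ 3 ≤ finrank ℝ E := by omega
  · obtain ⟨C, hC⟩ := lintegral_enorm_rpow_le_of_finrank_eq_one h1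
      ((le_max_right r 3).trans' (by norm_num) : 2 ≤ max r 3)
    have h3 := le_max_right r 3
    refine ⟨max r 3, by linarith, le_max_left _ _, ?_, C, fun f ↦ (hC f).trans_eq ?_⟩
    · rw [h1]
      push_cast
      linarith
    · rw [h1]
      push_cast
      congr 2 <;> ring_nf
  · obtain ⟨k, hk⟩ := exists_nat_ge (max r 1)
    obtain ⟨C, hC⟩ := lintegral_enorm_even_pow_le_of_finrank_eq_two h2 k
    have hk1 := (le_max_right r 1).trans hk
    have hk2 := (le_max_left r 1).trans hk
    refine ⟨2 * ((k : ℝ) + 1), by linarith, by linarith, ?_, C, fun f ↦ (hC f).trans_eq ?_⟩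
    · rw [h2]
      push_cast
      linarith
    · rw [h2]
      push_cast
      rw [show 2 * (2 * ((k : ℝ) + 1) - 2) / 4 = k by ring,
        show 2 * ((k : ℝ) + 1) / 2 - k = 1 by ring, ENNReal.rpow_one]
  · set n : ℝ := (finrank ℝ E : ℝ) with hn
    have hn3 : (3 : ℝ) ≤ n := hn ▸ (by exact_mod_cast h3)
    have hn2 : 0 < n - 2 := by linarith
    have hq : 0 < 2 * n / (n - 2) := by positivity
    obtain ⟨C, hC⟩ := lintegral_enorm_rpow_le_of_two_lt_finrank (E := E) h3
      hq (by
        rw [← hn]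
        field_simp)
    have hβ : 2 * n / (n - 2) / 2 - n * (2 * n / (n - 2) - 2) / 4 = 0 := by
      field_simp
      ring
    refine ⟨2 * n / (n - 2), ?_, ?_, hβ.ge, C, fun f ↦ (hC f).trans_eq ?_⟩
    · rw [lt_div_iff₀ hn2]
      linarith
    · rw [le_div_iff₀ hn2]
      exact hr h3
    · rw [hβ, ENNReal.rpow_zero, mul_one, ← sub_eq_zero.1 hβ]

theorem exists_gagliardo_nirenberg (hE : 1 ≤ finrank ℝ E) {r : ℝ} (hr2 : 2 ≤ r)
    (hr : 3 ≤ finrank ℝ E → r * (finrank ℝ E - 2) ≤ 2 * finrank ℝ E) :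
    ∃ C : ℝ≥0, ∀ f : SchwartzMap E ℂ, ∫⁻ x, ‖f x‖ₑ ^ r ≤
      C * (∫⁻ x, ‖fderiv ℝ f x‖ₑ ^ (2 : ℝ)) ^ (finrank ℝ E * (r - 2) / 4) *
        (∫⁻ x, ‖f x‖ₑ ^ (2 : ℝ)) ^ (r / 2 - finrank ℝ E * (r - 2) / 4) := by
  obtain ⟨q, hq2, hrq, hβ, C, hC⟩ := exists_gagliardo_nirenberg_endpoint hE hr
  have hq0 : 0 < q - 2 := by linarith
  set s := (r - 2) / (q - 2) with hs
  have hs0 : 0 ≤ s := div_nonneg (by linarith) hq0.le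
  have hs1 : 0 ≤ 1 - s := by
    rw [sub_nonneg, hs, div_le_one hq0]
    linarith
  have hsq : s * (q - 2) = r - 2 := div_mul_cancel₀ _ hq0.ne'
  refine ⟨C ^ s, fun f ↦ ?_⟩
  have hm := f.continuous.enorm.measurable
  calc ∫⁻ x, ‖f x‖ₑ ^ r = ∫⁻ x, (‖f x‖ₑ ^ (2 : ℝ)) ^ (1 - s) * (‖f x‖ₑ ^ q) ^ s := by
        refine lintegral_congr fun x ↦ ?_
        rw [← ENNReal.rpow_mul, ← ENNReal.rpow_mul,
          ← ENNReal.rpow_add_of_nonneg _ _ (by positivity) (by positivity)]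
        congr 1
        linear_combination -hsq
    _ ≤ (∫⁻ x, ‖f x‖ₑ ^ (2 : ℝ)) ^ (1 - s) * (∫⁻ x, ‖f x‖ₑ ^ q) ^ s :=
        ENNReal.lintegral_mul_norm_pow_le (hm.pow_const _).aemeasurable
          (hm.pow_const _).aemeasurable hs1 hs0 (by ring)
    _ ≤ (∫⁻ x, ‖f x‖ₑ ^ (2 : ℝ)) ^ (1 - s) *
        (C * (∫⁻ x, ‖fderiv ℝ f x‖ₑ ^ (2 : ℝ)) ^ (finrank ℝ E * (q - 2) / 4) *
          (∫⁻ x, ‖f x‖ₑ ^ (2 : ℝ)) ^ (q / 2 - finrank ℝ E * (q - 2) / 4)) ^ s := by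
        gcongr
        exact hC f
    _ = _ := by
        simp only [ENNReal.mul_rpow_of_nonneg _ _ hs0, ← ENNReal.rpow_mul]
        rw [show finrank ℝ E * (q - 2) / 4 * s = finrank ℝ E * (r - 2) / 4 by
            linear_combination (finrank ℝ E / 4 : ℝ) * hsq,
          show r / 2 - finrank ℝ E * (r - 2) / 4 =
            (1 - s) + (q / 2 - finrank ℝ E * (q - 2) / 4) * s by
            linear_combination ((finrank ℝ E : ℝ) / 4 - 1 / 2) * hsq,
          ENNReal.rpow_add_of_nonneg _ _ hs1 (mul_nonneg hβ hs0), ENNReal.coe_rpow_of_nonneg _ hs0]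
        ring

end Endpoint

section Weighted

variable {E : Type*} [NormedAddCommGroup E] [InnerProductSpace ℝ E] [FiniteDimensional ℝ E]
  [MeasurableSpace E] [BorelSpace E]

theorem exists_setLIntegral_ball_norm_rpow_le (hE : 1 ≤ finrank ℝ E) {s : ℝ}
    (hs : s < finrank ℝ E) : ∃ K : ℝ, 0 ≤ K ∧ ∀ R : ℝ, 0 < R →
      ∫⁻ x in Metric.ball (0 : E) R, ENNReal.ofReal (‖x‖ ^ (-s)) ≤
        ENNReal.ofReal (K * R ^ (finrank ℝ E - s)) := by
  have hint (R : ℝ) : IntegrableOn (fun x : E ↦ ‖x‖ ^ (-s)) (Metric.ball 0 R) :=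
    integrableOn_ball_of_norm_le_rpow (C := 1) hE hs
      (.of_forall fun x ↦ by rw [Real.norm_of_nonneg (by positivity), one_mul])
      (measurable_norm.pow_const _).aestronglyMeasurable
  refine ⟨∫ x in Metric.ball (0 : E) 1, ‖x‖ ^ (-s),
    integral_nonneg fun x ↦ by positivity, fun R hR ↦ ?_⟩
  rw [← ofReal_integral_eq_lintegral_ofReal (hint R) (.of_forall fun x ↦ by positivity)]
  refine ENNReal.ofReal_le_ofReal (le_of_eq ?_)
  have h := Measure.setIntegral_comp_smul_of_pos (volume : Measure E) (fun x ↦ ‖x‖ ^ (-s))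
    (Metric.ball 0 1) hR
  simp_rw [norm_smul, Real.norm_of_nonneg hR.le, Real.mul_rpow hR.le (norm_nonneg _)] at h
  rw [smul_unitBall_of_pos hR, integral_const_mul, smul_eq_mul,
    eq_inv_mul_iff_mul_eq₀ (by positivity)] at h
  rw [← h, sub_eq_add_neg, Real.rpow_add hR, Real.rpow_natCast]
  ring

theorem lintegral_enorm_sq_eq_ofReal_integral {F : Type*} [NormedAddCommGroup F] {g : E → F}
    (hg : MemLp g 2 volume) :
    ∫⁻ x, ‖g x‖ₑ ^ (2 : ℝ) = ENNReal.ofReal (∫ x, ‖g x‖ ^ 2) := by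
  rw [ofReal_integral_eq_lintegral_ofReal ((memLp_two_iff_integrable_sq_norm hg.1).1 hg)
    (.of_forall fun x ↦ by positivity)]
  refine lintegral_congr fun x ↦ ?_
  rw [ENNReal.ofReal_pow (norm_nonneg _), ofReal_norm, ← ENNReal.rpow_natCast]
  norm_num

theorem exists_gagliardo_nirenberg_ofReal (hE : 1 ≤ finrank ℝ E) {r : ℝ} (hr2 : 2 ≤ r)
    (hr : r * (finrank ℝ E - 2) ≤ 2 * finrank ℝ E) :
    ∃ C : ℝ, 0 ≤ C ∧ ∀ f : SchwartzMap E ℂ, ∫⁻ x, ‖f x‖ₑ ^ r ≤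
      ENNReal.ofReal (C * (∫ x, ‖fderiv ℝ f x‖ ^ 2) ^ (finrank ℝ E * (r - 2) / 4) *
        (∫ x, ‖f x‖ ^ 2) ^ (r / 2 - finrank ℝ E * (r - 2) / 4)) := by
  obtain ⟨C, hC⟩ := exists_gagliardo_nirenberg (E := E) hE hr2 fun _ ↦ hr
  refine ⟨C, C.coe_nonneg, fun f ↦ (hC f).trans_eq ?_⟩
  have hf' : MemLp (fderiv ℝ f) 2 volume := (SchwartzMap.fderivCLM ℝ E ℂ f).memLp 2 volume
  have ha : 0 ≤ ∫ x, ‖fderiv ℝ f x‖ ^ 2 := integral_nonneg fun x ↦ by positivity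
  have hm : 0 ≤ ∫ x, ‖f x‖ ^ 2 := integral_nonneg fun x ↦ by positivity
  have hn : (0 : ℝ) ≤ finrank ℝ E * (r - 2) / 4 := by
    have : 0 ≤ r - 2 := by linarith
    positivity
  rw [lintegral_enorm_sq_eq_ofReal_integral hf', lintegral_enorm_sq_eq_ofReal_integral (f.memLp 2),
    ENNReal.ofReal_rpow_of_nonneg ha hn, ENNReal.ofReal_rpow_of_nonneg hm (by linarith),
    ENNReal.ofReal_mul (by positivity), ENNReal.ofReal_mul C.coe_nonneg, ENNReal.ofReal_coe_nnreal]

theorem exists_weighted_gagliardo_nirenberg_aux (hE : 1 ≤ finrank ℝ E) {b p : ℝ} (hb0 : 0 < b)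
    (hbE : b < finrank ℝ E) (hp : 2 < p) (hpE : p * (finrank ℝ E - 2) < 2 * (finrank ℝ E - b)) :
    ∃ C : ℝ, 0 ≤ C ∧ ∀ f : SchwartzMap E ℂ, 0 < ∫ x, ‖fderiv ℝ f x‖ ^ 2 → 0 < ∫ x, ‖f x‖ ^ 2 →
      ∫⁻ x, ENNReal.ofReal (‖x‖ ^ (-b)) * ‖f x‖ₑ ^ p ≤
        ENNReal.ofReal (C * (∫ x, ‖fderiv ℝ f x‖ ^ 2) ^ ((finrank ℝ E * (p - 2) + 2 * b) / 4) *
          (∫ x, ‖f x‖ ^ 2) ^ (p / 2 - (finrank ℝ E * (p - 2) + 2 * b) / 4)) := by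
  set n : ℝ := (finrank ℝ E : ℝ) with hn
  have hn0 : 0 < n := hb0.trans hbE
  obtain ⟨s, hs, hs1⟩ : ∃ s, max 0 (p * (n - 2) / (2 * n)) < s ∧ s < 1 - b / n := by
    refine exists_between (max_lt ?_ ?_)
    · rw [sub_pos, div_lt_one hn0]
      exact hbE
    · rw [div_lt_iff₀ (by positivity)]
      field_simp
      linarith
  obtain ⟨hs0, hps⟩ := max_lt_iff.1 hs
  have hbn : 0 < b / n := by positivity
  have hs1' : 0 < 1 - s := by linarith
  have hbs : b / (1 - s) < n := by
    rw [div_lt_iff₀ hs1', ← div_lt_iff₀' hn0]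
    linarith
  have hp2 : 2 ≤ p / s := by
    rw [le_div_iff₀ hs0]
    nlinarith
  have hpsE : p / s * (n - 2) ≤ 2 * n := by
    rw [div_lt_iff₀ (by positivity)] at hps
    rw [div_mul_eq_mul_div, div_le_iff₀ hs0]
    linarith
  obtain ⟨K, hK0, hK⟩ := exists_setLIntegral_ball_norm_rpow_le hE hbs
  obtain ⟨C₁, hC₁0, hC₁⟩ := exists_gagliardo_nirenberg_ofReal hE hp2 hpsE
  obtain ⟨C₂, hC₂0, hC₂⟩ := exists_gagliardo_nirenberg_ofReal (E := E) hE hp.le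
    (hpE.le.trans (by linarith))
  rw [← hn] at hK hC₁ hC₂
  refine ⟨K ^ (1 - s) * C₁ ^ s + C₂, by positivity, fun f ha hm ↦ ?_⟩
  specialize hC₁ f
  specialize hC₂ f
  generalize (∫ x, ‖fderiv ℝ f x‖ ^ 2) = a at *
  generalize (∫ x, ‖f x‖ ^ 2) = m at *
  set R : ℝ := (m / a) ^ (1 / 2 : ℝ) with hRdef
  have hR : 0 < R := by positivity
  have hRpow (t : ℝ) : R ^ t = m ^ (t / 2) * a ^ (-(t / 2)) := by
    rw [hRdef, ← Real.rpow_mul (by positivity), Real.div_rpow hm.le ha.le, Real.rpow_neg ha.le,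
      div_eq_mul_inv, show 1 / 2 * t = t / 2 by ring]
  have hfm := f.continuous.enorm.measurable
  have hwm (t : ℝ) : Measurable fun x : E ↦ ENNReal.ofReal (‖x‖ ^ t) :=
    (measurable_norm.pow_const _).ennreal_ofReal
  have hinner : ∫⁻ x in Metric.ball (0 : E) R, ENNReal.ofReal (‖x‖ ^ (-b)) * ‖f x‖ₑ ^ p ≤
      ENNReal.ofReal (K ^ (1 - s) * C₁ ^ s * a ^ ((n * (p - 2) + 2 * b) / 4) *
        m ^ (p / 2 - (n * (p - 2) + 2 * b) / 4)) := by
    calc ∫⁻ x in Metric.ball (0 : E) R, ENNReal.ofReal (‖x‖ ^ (-b)) * ‖f x‖ₑ ^ p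
        = ∫⁻ x in Metric.ball (0 : E) R,
            ENNReal.ofReal (‖x‖ ^ (-(b / (1 - s)))) ^ (1 - s) * (‖f x‖ₑ ^ (p / s)) ^ s := by
          refine lintegral_congr fun x ↦ ?_
          rw [ENNReal.ofReal_rpow_of_nonneg (by positivity) hs1'.le,
            ← Real.rpow_mul (norm_nonneg _), ← ENNReal.rpow_mul, neg_mul,
            div_mul_cancel₀ _ hs1'.ne', div_mul_cancel₀ _ hs0.ne']
      _ ≤ (∫⁻ x in Metric.ball (0 : E) R, ENNReal.ofReal (‖x‖ ^ (-(b / (1 - s))))) ^ (1 - s) *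
            (∫⁻ x in Metric.ball (0 : E) R, ‖f x‖ₑ ^ (p / s)) ^ s :=
          ENNReal.lintegral_mul_norm_pow_le (hwm _).aemeasurable (hfm.pow_const _).aemeasurable
            hs1'.le hs0.le (by ring)
      _ ≤ ENNReal.ofReal (K * R ^ (n - b / (1 - s))) ^ (1 - s) *
            ENNReal.ofReal (C₁ * a ^ (n * (p / s - 2) / 4) *
              m ^ (p / s / 2 - n * (p / s - 2) / 4)) ^ s := by
          gcongr
          · exact hK R hR
          · exact (setLIntegral_le_lintegral _ _).trans hC₁
      _ = _ := by
          rw [ENNReal.ofReal_rpow_of_nonneg (by positivity) hs1'.le,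
            ENNReal.ofReal_rpow_of_nonneg (by positivity) hs0.le,
            ← ENNReal.ofReal_mul (by positivity), Real.mul_rpow hK0 (by positivity),
            Real.mul_rpow (by positivity) (by positivity), Real.mul_rpow hC₁0 (by positivity),
            ← Real.rpow_mul hR.le, ← Real.rpow_mul ha.le, ← Real.rpow_mul hm.le, hRpow]
          have e1 : (n * (p - 2) + 2 * b) / 4 =
              -((n - b / (1 - s)) * (1 - s) / 2) + n * (p / s - 2) / 4 * s := by
            field_simp
            ring
          have e2 : p / 2 - (n * (p - 2) + 2 * b) / 4 =
              (n - b / (1 - s)) * (1 - s) / 2 + (p / s / 2 - n * (p / s - 2) / 4) * s := by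
            field_simp
            ring
          rw [e2, e1, Real.rpow_add ha, Real.rpow_add hm]
          congr 1
          ring
  have houter : ∫⁻ x in (Metric.ball (0 : E) R)ᶜ, ENNReal.ofReal (‖x‖ ^ (-b)) * ‖f x‖ₑ ^ p ≤
      ENNReal.ofReal (C₂ * a ^ ((n * (p - 2) + 2 * b) / 4) *
        m ^ (p / 2 - (n * (p - 2) + 2 * b) / 4)) := by
    calc ∫⁻ x in (Metric.ball (0 : E) R)ᶜ, ENNReal.ofReal (‖x‖ ^ (-b)) * ‖f x‖ₑ ^ p
        ≤ ∫⁻ x in (Metric.ball (0 : E) R)ᶜ, ENNReal.ofReal (R ^ (-b)) * ‖f x‖ₑ ^ p := by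
          refine setLIntegral_mono' measurableSet_ball.compl fun x hx ↦ ?_
          have hx' : R ≤ ‖x‖ := by simpa using hx
          gcongr ENNReal.ofReal ?_ * _
          exact Real.rpow_le_rpow_of_nonpos hR hx' (by linarith)
      _ ≤ ENNReal.ofReal (R ^ (-b)) * ∫⁻ x, ‖f x‖ₑ ^ p := by
          rw [← lintegral_const_mul' _ _ ENNReal.ofReal_ne_top]
          exact setLIntegral_le_lintegral _ _
      _ ≤ ENNReal.ofReal (R ^ (-b)) * ENNReal.ofReal (C₂ * a ^ (n * (p - 2) / 4) *
            m ^ (p / 2 - n * (p - 2) / 4)) := by gcongr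
      _ = _ := by
          rw [← ENNReal.ofReal_mul (by positivity), hRpow,
            show (n * (p - 2) + 2 * b) / 4 = -(-b / 2) + n * (p - 2) / 4 by ring,
            show p / 2 - (-(-b / 2) + n * (p - 2) / 4) =
              -b / 2 + (p / 2 - n * (p - 2) / 4) by ring, Real.rpow_add ha, Real.rpow_add hm]
          congr 1
          ring
  rw [← lintegral_add_compl _ measurableSet_ball, add_mul, add_mul,
    ENNReal.ofReal_add (by positivity) (by positivity)]
  exact add_le_add hinner houter

theorem exists_weighted_gagliardo_nirenberg (hE : 1 ≤ finrank ℝ E) {b p : ℝ} (hb0 : 0 < b)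
    (hbE : b < finrank ℝ E) (hp : 2 < p) (hpE : p * (finrank ℝ E - 2) < 2 * (finrank ℝ E - b)) :
    ∃ C : ℝ, 0 < C ∧ ∀ f : SchwartzMap E ℂ, ∫ x, ‖x‖ ^ (-b) * ‖f x‖ ^ p ≤
      C * (∫ x, ‖fderiv ℝ f x‖ ^ 2) ^ ((finrank ℝ E * (p - 2) + 2 * b) / 4) *
        (∫ x, ‖f x‖ ^ 2) ^ (p / 2 - (finrank ℝ E * (p - 2) + 2 * b) / 4) := by
  obtain ⟨C, hC0, hC⟩ := exists_weighted_gagliardo_nirenberg_aux hE hb0 hbE hp hpE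
  obtain ⟨C₂, -, hC₂⟩ := exists_gagliardo_nirenberg_ofReal (E := E) hE hp.le
    (hpE.le.trans (by linarith))
  refine ⟨C + 1, by linarith, fun f ↦ ?_⟩
  have ha : 0 ≤ ∫ x, ‖fderiv ℝ f x‖ ^ 2 := integral_nonneg fun x ↦ by positivity
  have hm : 0 ≤ ∫ x, ‖f x‖ ^ 2 := integral_nonneg fun x ↦ by positivity
  have hwm : Measurable fun x : E ↦ ‖x‖ ^ (-b) * ‖f x‖ ^ p :=
    (measurable_norm.pow_const _).mul (f.continuous.norm.measurable.pow_const _)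
  by_cases h : 0 < ∫ x, ‖fderiv ℝ f x‖ ^ 2 ∧ 0 < ∫ x, ‖f x‖ ^ 2
  · rw [integral_eq_lintegral_of_nonneg_ae (.of_forall fun x ↦ by positivity)
      hwm.aestronglyMeasurable]
    refine ENNReal.toReal_le_of_le_ofReal (by positivity) ?_
    calc ∫⁻ x, ENNReal.ofReal (‖x‖ ^ (-b) * ‖f x‖ ^ p)
        = ∫⁻ x, ENNReal.ofReal (‖x‖ ^ (-b)) * ‖f x‖ₑ ^ p := by
          refine lintegral_congr fun x ↦ ?_
          rw [ENNReal.ofReal_mul (by positivity),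
            ← ENNReal.ofReal_rpow_of_nonneg (norm_nonneg (f x)) (by linarith), ofReal_norm]
      _ ≤ _ := hC f h.1 h.2
      _ ≤ _ := by
          gcongr
          linarith
  · have hn0 : (0 : ℝ) < finrank ℝ E := hb0.trans hbE
    have hzero : ∫⁻ x, ‖f x‖ₑ ^ p = 0 := by
      refine le_antisymm ((hC₂ f).trans_eq ?_) zero_le
      rw [ENNReal.ofReal_eq_zero]
      refine le_of_eq ?_
      rcases not_and_or.1 h with h | h
      · rw [le_antisymm (not_lt.1 h) ha, Real.zero_rpow (by nlinarith), mul_zero, zero_mul]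
      · rw [le_antisymm (not_lt.1 h) hm, Real.zero_rpow (by linarith), mul_zero]
    rw [lintegral_eq_zero_iff (f.continuous.enorm.measurable.pow_const _)] at hzero
    rw [integral_eq_zero_of_ae]
    · positivity
    · filter_upwards [hzero] with x hx
      have hx' : f x = 0 := by
        simpa [(by linarith : 0 < p), (by linarith : ¬ p < 0)] using hx
      simp [hx', (by linarith : p ≠ 0)]

end Weighted

/-- Weighted Gagliardo–Nirenberg inequality with singular weight `|x|^{-b}`. -/
theorem stmt_0 (d : ℕ) (hd : 1 ≤ d) (b σ : ℝ) (hb0 : 0 < b) (hb2 : b < 2)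
    (hbd : b < (d : ℝ)) (hσ0 : 0 < σ) (hσc : 3 ≤ d → σ < (4 - 2 * b) / ((d : ℝ) - 2)) :
    ∃ C : ℝ, 0 < C ∧ ∀ f : SchwartzMap (EuclideanSpace ℝ (Fin d)) ℂ,
      (∫ x : EuclideanSpace ℝ (Fin d), ‖x‖ ^ (-b) * ‖f x‖ ^ (σ + 2))
        ≤ C * (∫ x : EuclideanSpace ℝ (Fin d), ‖fderiv ℝ (⇑f) x‖ ^ 2) ^ (((d : ℝ) * σ + 2 * b) / 4)
            * (∫ x : EuclideanSpace ℝ (Fin d), ‖f x‖ ^ 2) ^ ((4 - 2 * b - σ * ((d : ℝ) - 2)) / 4) := by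
  have hfin : finrank ℝ (EuclideanSpace ℝ (Fin d)) = d := finrank_euclideanSpace_fin
  have hsub : (σ + 2) * ((d : ℝ) - 2) < 2 * (d - b) := by
    rcases le_or_gt 3 d with h3 | h3
    · have hd3 : (3 : ℝ) ≤ d := by exact_mod_cast h3
      have := hσc h3
      rw [lt_div_iff₀ (by linarith)] at this
      linarith
    · have hd2 : (d : ℝ) ≤ 2 := by exact_mod_cast Nat.lt_succ_iff.1 h3
      nlinarith
  obtain ⟨C, hC0, hC⟩ := exists_weighted_gagliardo_nirenberg (E := EuclideanSpace ℝ (Fin d))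
    (p := σ + 2) (by rwa [hfin]) hb0 (by rwa [hfin]) (by linarith) (by rwa [hfin])
  refine ⟨C, hC0, fun f ↦ (hC f).trans_eq ?_⟩
  rw [hfin]
  congr 2
  · ring_nf
  · ring
end

section
/- Let d ≥ 3 be a natural number, let b be a real number with 0 < b < 2, and set q = 2(d − b)/(d − 2). Then there exists a constant C > 0 such that for every Schwartz function f : ℝ^d → ℂ one has (∫_{ℝ^d} |x|^{−b} |f(x)|^{q} dx)^{1/q} ≤ C · (∫_{ℝ^d} |∇f(x)|² dx)^{1/2}. -/
open MeasureTheory Set Filter Topology Module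
open scoped ENNReal NNReal

theorem enorm_le_enorm_mul_lintegral_Ioi_fderiv_smul {E F : Type*} [NormedAddCommGroup E]
    [NormedSpace ℝ E] [NormedAddCommGroup F] [NormedSpace ℝ F] [CompleteSpace F] {u : E → F}
    (hu : ContDiff ℝ 1 u) (h2u : HasCompactSupport u) {x : E} (hx : x ≠ 0) :
    ‖u x‖ₑ ≤ ‖x‖ₑ * ∫⁻ t in Ioi (1 : ℝ), ‖fderiv ℝ u (t • x)‖ₑ := by
  have hg : ContDiff ℝ 1 (fun t : ℝ ↦ u (t • x)) := by fun_prop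
  have hgc : HasCompactSupport (fun t : ℝ ↦ u (t • x)) :=
    h2u.comp_isClosedEmbedding (isClosedEmbedding_smul_left hx)
  have hderiv (t : ℝ) : deriv (fun t : ℝ ↦ u (t • x)) t = fderiv ℝ u (t • x) x := by
    have h1 : HasDerivAt (fun t : ℝ ↦ t • x) x t := by
      simpa using (hasDerivAt_id t).smul_const x
    exact ((hu.differentiable one_ne_zero (t • x)).hasFDerivAt.comp_hasDerivAt t h1).deriv
  have key := hgc.integral_Ioi_deriv_eq hg 1
  simp only [one_smul] at key
  calc ‖u x‖ₑ = ‖∫ t in Ioi (1 : ℝ), deriv (fun t : ℝ ↦ u (t • x)) t‖ₑ := by rw [key, enorm_neg]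
    _ ≤ ∫⁻ t in Ioi (1 : ℝ), ‖deriv (fun t : ℝ ↦ u (t • x)) t‖ₑ :=
        enorm_integral_le_lintegral_enorm _
    _ ≤ ∫⁻ t in Ioi (1 : ℝ), ‖x‖ₑ * ‖fderiv ℝ u (t • x)‖ₑ := by
        gcongr with t
        rw [hderiv, mul_comm]
        exact ContinuousLinearMap.le_opENorm _ _
    _ = _ := lintegral_const_mul' _ _ (by simp)

theorem lintegral_Ioi_one_rpow_neg_three_halves :
    ∫⁻ t in Ioi (1 : ℝ), ENNReal.ofReal (t ^ (-(3 / 2) : ℝ)) = 2 := by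
  rw [← ofReal_integral_eq_lintegral_ofReal
    (integrableOn_Ioi_rpow_of_lt (by norm_num) zero_lt_one)
    (ae_restrict_of_forall_mem measurableSet_Ioi fun t ht ↦ by
      have : (0 : ℝ) < t := zero_lt_one.trans ht
      simp only [Pi.zero_apply]; positivity),
    integral_Ioi_rpow_of_lt (by norm_num) zero_lt_one]
  norm_num

theorem sq_lintegral_Ioi_one_le {g : ℝ → ℝ≥0∞} (hg : Measurable g) :
    (∫⁻ t in Ioi (1 : ℝ), g t) ^ (2 : ℝ) ≤
      2 * ∫⁻ t in Ioi (1 : ℝ), ENNReal.ofReal (t ^ (3 / 2 : ℝ)) * g t ^ (2 : ℝ) := by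
  have hI := lintegral_Ioi_one_rpow_neg_three_halves
  have h := ENNReal.lintegral_mul_norm_pow_le (μ := volume.restrict (Ioi (1 : ℝ)))
    (f := fun t ↦ ENNReal.ofReal (t ^ (-(3 / 2) : ℝ)))
    (g := fun t ↦ ENNReal.ofReal (t ^ (3 / 2 : ℝ)) * g t ^ (2 : ℝ))
    (by fun_prop) (by fun_prop) (p := 1 / 2) (q := 1 / 2) (by norm_num) (by norm_num) (by norm_num)
  have heq : ∫⁻ t in Ioi (1 : ℝ), g t = ∫⁻ t in Ioi (1 : ℝ),
      ENNReal.ofReal (t ^ (-(3 / 2) : ℝ)) ^ (1 / 2 : ℝ) *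
        (ENNReal.ofReal (t ^ (3 / 2 : ℝ)) * g t ^ (2 : ℝ)) ^ (1 / 2 : ℝ) := by
    refine setLIntegral_congr_fun measurableSet_Ioi fun t ht ↦ ?_
    have h0 : (0 : ℝ) < t := zero_lt_one.trans ht
    rw [← ENNReal.mul_rpow_of_nonneg _ _ (by norm_num), ← mul_assoc,
      ← ENNReal.ofReal_mul (by positivity), ← Real.rpow_add h0, neg_add_cancel, Real.rpow_zero,
      ENNReal.ofReal_one, one_mul, ← ENNReal.rpow_mul]
    norm_num
  rw [← heq, hI] at h
  calc _ ≤ _ := ENNReal.rpow_le_rpow h (by norm_num : (0 : ℝ) ≤ 2)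
    _ = _ := by
      rw [← ENNReal.mul_rpow_of_nonneg _ _ (by norm_num), ← ENNReal.rpow_mul]
      norm_num

section

variable {E F : Type*} [NormedAddCommGroup E] [NormedSpace ℝ E] [FiniteDimensional ℝ E]
  [MeasurableSpace E] [BorelSpace E] [NormedAddCommGroup F]

theorem lintegral_comp_smul_eq (μ : Measure E) [μ.IsAddHaarMeasure] {g : E → ℝ≥0∞}
    (hg : Measurable g) {t : ℝ} (ht : 0 < t) :
    ∫⁻ x, g (t • x) ∂μ = ENNReal.ofReal (t ^ (-(finrank ℝ E : ℝ))) * ∫⁻ x, g x ∂μ := by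
  rw [← lintegral_map hg (measurable_const_smul t), Measure.map_addHaar_smul μ ht.ne',
    lintegral_smul_measure, Real.rpow_neg ht.le, Real.rpow_natCast, abs_of_pos (by positivity),
    smul_eq_mul]

variable [NormedSpace ℝ F]

/-- Hardy's inequality for compactly supported functions, with a non-optimal constant. -/
theorem lintegral_rpow_neg_two_mul_le_lintegral_fderiv [CompleteSpace F] (μ : Measure E)
    [μ.IsAddHaarMeasure] (hE : 3 ≤ finrank ℝ E) {u : E → F}
    (hu : ContDiff ℝ 1 u) (h2u : HasCompactSupport u) :
    ∫⁻ x, ENNReal.ofReal (‖x‖ ^ (-2 : ℝ)) * ‖u x‖ₑ ^ (2 : ℝ) ∂μ ≤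
      4 * ∫⁻ x, ‖fderiv ℝ u x‖ₑ ^ (2 : ℝ) ∂μ := by
  have hcont : Continuous (fderiv ℝ u) := hu.continuous_fderiv one_ne_zero
  set D := ∫⁻ x, ‖fderiv ℝ u x‖ₑ ^ (2 : ℝ) ∂μ with hD
  have hpt (x : E) : ENNReal.ofReal (‖x‖ ^ (-2 : ℝ)) * ‖u x‖ₑ ^ (2 : ℝ) ≤
      2 * ∫⁻ t in Ioi (1 : ℝ),
        ENNReal.ofReal (t ^ (3 / 2 : ℝ)) * ‖fderiv ℝ u (t • x)‖ₑ ^ (2 : ℝ) := by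
    rcases eq_or_ne x 0 with rfl | hx
    · simp
    have hx' : 0 < ‖x‖ := norm_pos_iff.mpr hx
    calc _ ≤ ENNReal.ofReal (‖x‖ ^ (-2 : ℝ)) *
          (‖x‖ₑ * ∫⁻ t in Ioi (1 : ℝ), ‖fderiv ℝ u (t • x)‖ₑ) ^ (2 : ℝ) := by
          gcongr
          exact enorm_le_enorm_mul_lintegral_Ioi_fderiv_smul hu h2u hx
      _ = (∫⁻ t in Ioi (1 : ℝ), ‖fderiv ℝ u (t • x)‖ₑ) ^ (2 : ℝ) := by
          rw [ENNReal.mul_rpow_of_nonneg _ _ (by norm_num), ← mul_assoc, ← ofReal_norm,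
            ENNReal.ofReal_rpow_of_pos hx', ← ENNReal.ofReal_mul (by positivity),
            ← Real.rpow_add hx', neg_add_cancel, Real.rpow_zero, ENNReal.ofReal_one, one_mul]
      _ ≤ _ := sq_lintegral_Ioi_one_le (by fun_prop)
  have hmeas : Measurable (fun p : E × ℝ ↦
      ENNReal.ofReal (p.2 ^ (3 / 2 : ℝ)) * ‖fderiv ℝ u (p.2 • p.1)‖ₑ ^ (2 : ℝ)) := by
    have : Continuous (fun p : E × ℝ ↦ ‖fderiv ℝ u (p.2 • p.1)‖ₑ) := by fun_prop
    have := this.measurable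
    fun_prop
  calc _ ≤ ∫⁻ x, 2 * (∫⁻ t in Ioi (1 : ℝ),
        ENNReal.ofReal (t ^ (3 / 2 : ℝ)) * ‖fderiv ℝ u (t • x)‖ₑ ^ (2 : ℝ)) ∂μ :=
        lintegral_mono hpt
    _ = 2 * ∫⁻ t in Ioi (1 : ℝ), ∫⁻ x,
        ENNReal.ofReal (t ^ (3 / 2 : ℝ)) * ‖fderiv ℝ u (t • x)‖ₑ ^ (2 : ℝ) ∂μ := by
        rw [lintegral_const_mul' _ _ (by simp), lintegral_lintegral_swap hmeas.aemeasurable]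
    _ ≤ 2 * ∫⁻ t in Ioi (1 : ℝ), ENNReal.ofReal (t ^ (-(3 / 2) : ℝ)) * D := by
        gcongr 2 * ?_
        refine setLIntegral_mono (by fun_prop) fun t ht ↦ ?_
        have h0 : (0 : ℝ) < t := zero_lt_one.trans ht
        have h3 : (3 : ℝ) ≤ finrank ℝ E := by exact_mod_cast hE
        rw [lintegral_const_mul' _ _ (by simp), lintegral_comp_smul_eq μ
          (g := fun y ↦ ‖fderiv ℝ u y‖ₑ ^ (2 : ℝ)) (by fun_prop) h0, ← mul_assoc,
          ← ENNReal.ofReal_mul (by positivity), ← Real.rpow_add h0]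
        gcongr
        · exact le_of_lt ht
        · linarith
    _ = _ := by
        rw [lintegral_mul_const _ (by fun_prop), lintegral_Ioi_one_rpow_neg_three_halves,
          ← mul_assoc, show (2 : ℝ≥0∞) * 2 = 4 by norm_num]

/-- The Hardy–Sobolev inequality for compactly supported functions. -/
theorem exists_lintegral_rpow_neg_mul_le_of_hasCompactSupport (μ : Measure E)
    [μ.IsAddHaarMeasure] [FiniteDimensional ℝ F] (hE : 3 ≤ finrank ℝ E) {b q : ℝ} (hb0 : 0 < b)
    (hb2 : b < 2) (hq : q = 2 * (finrank ℝ E - b) / (finrank ℝ E - 2)) :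
    ∃ K : ℝ≥0, ∀ u : E → F, ContDiff ℝ 1 u → HasCompactSupport u →
      ∫⁻ x, ENNReal.ofReal (‖x‖ ^ (-b)) * ‖u x‖ₑ ^ q ∂μ ≤
        (K * eLpNorm (fderiv ℝ u) 2 μ) ^ q := by
  have : CompleteSpace F := FiniteDimensional.complete ℝ F
  set n : ℝ := (finrank ℝ E : ℝ) with hn
  have h3 : (3 : ℝ) ≤ n := by rw [hn]; exact_mod_cast hE
  have hn2 : 0 < n - 2 := by linarith
  set p : ℝ≥0 := (2 * n / (n - 2)).toNNReal
  have hp : (p : ℝ) = 2 * n / (n - 2) := Real.coe_toNNReal _ (by positivity)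
  have hp0 : 0 < (p : ℝ) := by rw [hp]; positivity
  set S := SNormLESNormFDerivOfEqConst F μ (2 : ℝ≥0)
  refine ⟨2 + S, fun u hu h2u ↦ ?_⟩
  have hcont : Continuous (fderiv ℝ u) := hu.continuous_fderiv one_ne_zero
  have hcu : Continuous u := hu.continuous
  set N := eLpNorm (fderiv ℝ u) 2 μ with hN
  have hNsq : ∫⁻ x, ‖fderiv ℝ u x‖ₑ ^ (2 : ℝ) ∂μ = N ^ (2 : ℝ) := by
    simpa using (eLpNorm_nnreal_pow_eq_lintegral (f := fderiv ℝ u) (μ := μ)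
      (p := 2) (by norm_num)).symm
  have hhardy : ∫⁻ x, ENNReal.ofReal (‖x‖ ^ (-2 : ℝ)) * ‖u x‖ₑ ^ (2 : ℝ) ∂μ ≤
      ((2 + S : ℝ≥0) * N) ^ (2 : ℝ) := by
    refine (lintegral_rpow_neg_two_mul_le_lintegral_fderiv μ hE hu h2u).trans ?_
    rw [hNsq, ENNReal.mul_rpow_of_nonneg _ _ (by norm_num)]
    gcongr
    calc (4 : ℝ≥0∞) = 2 ^ (2 : ℝ) := by norm_num
      _ ≤ _ := by
        gcongr
        push_cast
        exact le_self_add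
  have hsob : ∫⁻ x, ‖u x‖ₑ ^ (p : ℝ) ∂μ ≤ ((2 + S : ℝ≥0) * N) ^ (p : ℝ) := by
    have := eLpNorm_le_eLpNorm_fderiv_of_eq μ hu h2u (p := 2) (p' := p) (by norm_num)
      (by omega) (by rw [hp, ← hn]; push_cast; field_simp)
    rw [← eLpNorm_nnreal_pow_eq_lintegral (by exact_mod_cast hp0.ne')]
    refine ENNReal.rpow_le_rpow (this.trans ?_) hp0.le
    push_cast
    gcongr
    exact le_add_self
  have hqb : q = b + p * ((2 - b) / 2) := by
    rw [hq, hp]; field_simp; ring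
  have hpb : 0 ≤ p * ((2 - b) / 2) := mul_nonneg hp0.le (by linarith)
  calc _ = ∫⁻ x, (ENNReal.ofReal (‖x‖ ^ (-2 : ℝ)) * ‖u x‖ₑ ^ (2 : ℝ)) ^ (b / 2) *
        (‖u x‖ₑ ^ (p : ℝ)) ^ ((2 - b) / 2) ∂μ := by
        refine lintegral_congr fun x ↦ ?_
        rw [ENNReal.mul_rpow_of_nonneg _ _ (by positivity), ← ENNReal.rpow_mul, ← ENNReal.rpow_mul,
          ENNReal.ofReal_rpow_of_nonneg (by positivity) (by positivity),
          ← Real.rpow_mul (norm_nonneg x), mul_assoc, mul_div_cancel₀ b two_ne_zero,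
          ← ENNReal.rpow_add_of_nonneg _ _ hb0.le hpb, ← hqb,
          show (-2) * (b / 2) = -b by ring]
    _ ≤ (∫⁻ x, ENNReal.ofReal (‖x‖ ^ (-2 : ℝ)) * ‖u x‖ₑ ^ (2 : ℝ) ∂μ) ^ (b / 2) *
        (∫⁻ x, ‖u x‖ₑ ^ (p : ℝ) ∂μ) ^ ((2 - b) / 2) :=
        ENNReal.lintegral_mul_norm_pow_le (by fun_prop) (by fun_prop) (by positivity)
          (by linarith) (by ring)
    _ ≤ (((2 + S : ℝ≥0) * N) ^ (2 : ℝ)) ^ (b / 2) *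
        (((2 + S : ℝ≥0) * N) ^ (p : ℝ)) ^ ((2 - b) / 2) := by
        gcongr
    _ = _ := by
        rw [← ENNReal.rpow_mul, ← ENNReal.rpow_mul, mul_div_cancel₀ b two_ne_zero,
          ← ENNReal.rpow_add_of_nonneg _ _ hb0.le hpb, ← hqb]

/-- The Hardy–Sobolev inequality for continuously differentiable functions in `L²`. -/
theorem exists_lintegral_rpow_neg_mul_le (μ : Measure E)
    [μ.IsAddHaarMeasure] [FiniteDimensional ℝ F] (hE : 3 ≤ finrank ℝ E) {b q : ℝ} (hb0 : 0 < b)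
    (hb2 : b < 2) (hq : q = 2 * (finrank ℝ E - b) / (finrank ℝ E - 2)) :
    ∃ K : ℝ≥0, ∀ f : E → F, ContDiff ℝ 1 f → eLpNorm f 2 μ ≠ ⊤ →
      ∫⁻ x, ENNReal.ofReal (‖x‖ ^ (-b)) * ‖f x‖ₑ ^ q ∂μ ≤
        (K * eLpNorm (fderiv ℝ f) 2 μ) ^ q := by
  obtain ⟨K, hK⟩ := exists_lintegral_rpow_neg_mul_le_of_hasCompactSupport (F := F) μ hE hb0 hb2 hq
  refine ⟨K, fun f hf hf2 ↦ ?_⟩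
  let ψ : ContDiffBump (0 : E) := ⟨1, 2, one_pos, one_lt_two⟩
  have hψ : ContDiff ℝ 1 ψ := ψ.contDiff
  obtain ⟨L, hL⟩ : ∃ L : ℝ, ∀ x, ‖fderiv ℝ ψ x‖ ≤ L :=
    (hψ.continuous_fderiv one_ne_zero).bounded_above_of_compact_support
      (ψ.hasCompactSupport.fderiv ℝ)
  have hL0 : 0 ≤ L := (norm_nonneg _).trans (hL 0)
  let ε (k : ℕ) : ℝ := 1 / ((k : ℝ) + 1)
  have hε0 (k : ℕ) : 0 < ε k := by positivity
  have hε : Tendsto ε atTop (𝓝 0) := tendsto_one_div_add_atTop_nhds_zero_nat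
  let u (k : ℕ) (x : E) : F := ψ (ε k • x) • f x
  have hu (k : ℕ) : ContDiff ℝ 1 (u k) := (hψ.comp (contDiff_const_smul (ε k))).smul hf
  have h2u (k : ℕ) : HasCompactSupport (u k) :=
    HasCompactSupport.smul_right
      (ψ.hasCompactSupport.comp_homeomorph (Homeomorph.smulOfNeZero (ε k) (hε0 k).ne'))
  have hbound (k : ℕ) (x : E) :
      ‖fderiv ℝ (u k) x‖ ≤ ‖‖fderiv ℝ f x‖ + (ε k * L) • ‖f x‖‖ := by
    have h1 : HasFDerivAt (fun x : E ↦ ψ (ε k • x))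
        ((fderiv ℝ ψ (ε k • x)).comp (ε k • ContinuousLinearMap.id ℝ E)) x :=
      ((hψ.differentiable one_ne_zero (ε k • x)).hasFDerivAt).comp x
        ((hasFDerivAt_id x).const_smul (ε k))
    have h2 := h1.smul (hf.differentiable one_ne_zero x).hasFDerivAt
    have h3 : fderiv ℝ (u k) x = _ := h2.fderiv
    rw [h3, Real.norm_of_nonneg (by have := hε0 k; positivity)]
    refine (norm_add_le _ _).trans (add_le_add ?_ ?_)
    · rw [norm_smul, Real.norm_of_nonneg ψ.nonneg]
      exact mul_le_of_le_one_left (norm_nonneg _) ψ.le_one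
    · rw [ContinuousLinearMap.norm_smulRight_apply, ContinuousLinearMap.comp_smul,
        ContinuousLinearMap.comp_id, norm_smul, Real.norm_of_nonneg (hε0 k).le, smul_eq_mul]
      have := hε0 k
      gcongr
      exact hL _
  have hcont : Continuous (fderiv ℝ f) := hf.continuous_fderiv one_ne_zero
  have hcf : Continuous f := hf.continuous
  have hNk (k : ℕ) : eLpNorm (fderiv ℝ (u k)) 2 μ ≤
      eLpNorm (fderiv ℝ f) 2 μ + ENNReal.ofReal (ε k * L) * eLpNorm f 2 μ := by
    calc _ ≤ eLpNorm ((fun x ↦ ‖fderiv ℝ f x‖) + (ε k * L) • fun x ↦ ‖f x‖) 2 μ :=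
          eLpNorm_mono (hbound k)
      _ ≤ eLpNorm (fun x ↦ ‖fderiv ℝ f x‖) 2 μ + eLpNorm ((ε k * L) • fun x ↦ ‖f x‖) 2 μ :=
          eLpNorm_add_le hcont.norm.aestronglyMeasurable
            (hcf.norm.aestronglyMeasurable.const_smul _) (by norm_num)
      _ = _ := by
          rw [eLpNorm_const_smul, eLpNorm_norm, eLpNorm_norm,
            Real.enorm_of_nonneg (by have := hε0 k; positivity)]
  have hlim : Tendsto (fun k ↦ ((K : ℝ≥0∞) * (eLpNorm (fderiv ℝ f) 2 μ +
      ENNReal.ofReal (ε k * L) * eLpNorm f 2 μ)) ^ q) atTop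
      (𝓝 ((K * eLpNorm (fderiv ℝ f) 2 μ) ^ q)) := by
    have h1 : Tendsto (fun k ↦ ENNReal.ofReal (ε k * L)) atTop (𝓝 0) := by
      simpa using ENNReal.tendsto_ofReal (hε.mul_const L)
    have h2 := ENNReal.Tendsto.mul_const h1 (Or.inr hf2)
    rw [zero_mul] at h2
    have h3 := (tendsto_const_nhds (x := eLpNorm (fderiv ℝ f) 2 μ)).add h2
    rw [add_zero] at h3
    exact (ENNReal.continuous_rpow_const.tendsto _).comp
      (ENNReal.Tendsto.const_mul h3 (Or.inr ENNReal.coe_ne_top))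
  have hq0 : 0 ≤ q := by
    have h3 : (3 : ℝ) ≤ finrank ℝ E := by exact_mod_cast hE
    rw [hq]
    exact div_nonneg (by linarith) (by linarith)
  have hpt (x : E) : Tendsto (fun k ↦ ENNReal.ofReal (‖x‖ ^ (-b)) * ‖u k x‖ₑ ^ q) atTop
      (𝓝 (ENNReal.ofReal (‖x‖ ^ (-b)) * ‖f x‖ₑ ^ q)) := by
    refine tendsto_const_nhds.congr' ?_
    have h1 : Tendsto (fun k ↦ ε k • x) atTop (𝓝 0) := by
      simpa using hε.smul_const x
    filter_upwards [h1.eventually (Metric.closedBall_mem_nhds (0 : E) one_pos)] with k hk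
    simp only [u]
    rw [ψ.one_of_mem_closedBall hk, one_smul]
  have hmeas (k : ℕ) : Measurable (fun x ↦ ENNReal.ofReal (‖x‖ ^ (-b)) * ‖u k x‖ₑ ^ q) := by
    have := (hu k).continuous.enorm.measurable
    fun_prop
  calc _ = ∫⁻ x, liminf (fun k ↦ ENNReal.ofReal (‖x‖ ^ (-b)) * ‖u k x‖ₑ ^ q) atTop ∂μ :=
        lintegral_congr fun x ↦ (hpt x).liminf_eq.symm
    _ ≤ liminf (fun k ↦ ∫⁻ x, ENNReal.ofReal (‖x‖ ^ (-b)) * ‖u k x‖ₑ ^ q ∂μ) atTop :=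
        lintegral_liminf_le hmeas
    _ ≤ liminf (fun k ↦ ((K : ℝ≥0∞) * (eLpNorm (fderiv ℝ f) 2 μ +
          ENNReal.ofReal (ε k * L) * eLpNorm f 2 μ)) ^ q) atTop := by
        refine liminf_le_liminf (Eventually.of_forall fun k ↦ ?_)
        refine (hK (u k) (hu k) (h2u k)).trans ?_
        gcongr
        exact hNk k
    _ = _ := hlim.liminf_eq

end

/-- Hardy–Sobolev inequality. -/
theorem stmt_1 (d : ℕ) (hd : 3 ≤ d) (b q : ℝ) (hb0 : 0 < b) (hb2 : b < 2)
    (hq : q = 2 * ((d : ℝ) - b) / ((d : ℝ) - 2)) :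
    ∃ C : ℝ, 0 < C ∧ ∀ f : SchwartzMap (EuclideanSpace ℝ (Fin d)) ℂ,
      (∫ x : EuclideanSpace ℝ (Fin d), ‖x‖ ^ (-b) * ‖f x‖ ^ q) ^ (1 / q)
        ≤ C * (∫ x : EuclideanSpace ℝ (Fin d), ‖fderiv ℝ (⇑f) x‖ ^ 2) ^ ((1 : ℝ) / 2) := by
  have hfin : finrank ℝ (EuclideanSpace ℝ (Fin d)) = d := by simp
  obtain ⟨K, hK⟩ := exists_lintegral_rpow_neg_mul_le (F := ℂ) (q := q)
    (volume : Measure (EuclideanSpace ℝ (Fin d))) (by rwa [hfin]) hb0 hb2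
    (by rw [hfin]; exact hq)
  have hq0 : 0 < q := by
    have h3 : (3 : ℝ) ≤ d := by exact_mod_cast hd
    rw [hq]
    exact div_pos (by linarith) (by linarith)
  refine ⟨K + 1, by positivity, fun f ↦ ?_⟩
  set J := ∫ x : EuclideanSpace ℝ (Fin d), ‖fderiv ℝ (⇑f) x‖ ^ 2 with hJ
  have hJ0 : 0 ≤ J := integral_nonneg fun x ↦ by positivity
  have hmem : MemLp (fderiv ℝ f) 2 volume := by
    have h := (SchwartzMap.fderivCLM ℝ _ _ f).memLp 2 volume
    rwa [show ⇑(SchwartzMap.fderivCLM ℝ _ _ f) = fderiv ℝ f from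
      funext (SchwartzMap.fderivCLM_apply ℝ f)] at h
  have hN : eLpNorm (fderiv ℝ f) 2 volume = ENNReal.ofReal (J ^ ((1 : ℝ) / 2)) := by
    rw [hmem.eLpNorm_eq_integral_rpow_norm (by norm_num) (by norm_num)]
    simp [hJ]
  have hf : ContDiff ℝ 1 f := by exact_mod_cast f.smooth 1
  have hf2 : MemLp f 2 volume := f.memLp 2 volume
  have h := hK f hf hf2.eLpNorm_ne_top
  have hcf : Continuous f := f.continuous
  have hmeas : Measurable (fun x : EuclideanSpace ℝ (Fin d) ↦ ‖x‖ ^ (-b) * ‖f x‖ ^ q) := by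
    have := hcf.measurable
    fun_prop
  have hI : ∫ x : EuclideanSpace ℝ (Fin d), ‖x‖ ^ (-b) * ‖f x‖ ^ q ≤
      (K * J ^ ((1 : ℝ) / 2)) ^ q := by
    rw [integral_eq_lintegral_of_nonneg_ae (ae_of_all _ fun x ↦ by positivity)
      hmeas.aestronglyMeasurable]
    refine ENNReal.toReal_le_of_le_ofReal (by positivity) ?_
    rw [hN, ← ENNReal.ofReal_coe_nnreal, ← ENNReal.ofReal_mul (by positivity),
      ENNReal.ofReal_rpow_of_nonneg (by positivity) hq0.le] at h
    refine (lintegral_congr fun x ↦ ?_).trans_le h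
    rw [ENNReal.ofReal_mul (by positivity), ← ofReal_norm,
      ENNReal.ofReal_rpow_of_nonneg (norm_nonneg _) hq0.le]
  calc _ ≤ ((K * J ^ ((1 : ℝ) / 2)) ^ q) ^ (1 / q) := by
        refine Real.rpow_le_rpow (integral_nonneg fun x ↦ by positivity) hI (by positivity)
    _ = K * J ^ ((1 : ℝ) / 2) := by
        rw [one_div q, Real.rpow_rpow_inv (by positivity) hq0.ne']
    _ ≤ _ := by
        gcongr
        linarith
end
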